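/- Let (X,r) be a 2-cancellative quadratic set such that the monoid S(X,r) has cancellation on monomials of length 3. Then: (i) the following are equivalent: condition l2; condition r2; conditions l1 and r1 together; (X,r) is a braided set. (ii) If furthermore r is non-degenerate and involutive, then l1 holds iff r1 holds iff (X,r) is a symmetric set. -/

import Mathlib

/- Common framework for set-theoretic solutions of the Yang-Baxter equation
   (quadratic sets), following Gateva-Ivanova & Majid. -/

namespace YB

variable {X Y : Type*}

/-- Left action `^x y` : first component of `r (x, y)`. -/
def lact (r : X × X → X × X) (x y : X) : X := (r (x, y)).1

/-- Right action `x ^ y` : second component of `r (x, y)`. -/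
def ract (r : X × X → X × X) (x y : X) : X := (r (x, y)).2

def r12 (r : X × X → X × X) : X × X × X → X × X × X :=
  fun p => ((r (p.1, p.2.1)).1, (r (p.1, p.2.1)).2, p.2.2)

def r23 (r : X × X → X × X) : X × X × X → X × X × X :=
  fun p => (p.1, r (p.2.1, p.2.2))

/-- The Yang-Baxter equation (braided set condition). -/
def IsBraided (r : X × X → X × X) : Prop :=
  r12 r ∘ r23 r ∘ r12 r = r23 r ∘ r12 r ∘ r23 r

/-- l1 : `^x(^y z) = ^(^x y)(^(x^y) z)`. -/
def CondL1 (r : X × X → X × X) : Prop :=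
  ∀ x y z : X, lact r x (lact r y z) = lact r (lact r x y) (lact r (ract r x y) z)

/-- r1 : `(x^y)^z = (x^(^y z))^(y^z)`. -/
def CondR1 (r : X × X → X × X) : Prop :=
  ∀ x y z : X, ract r (ract r x y) z = ract r (ract r x (lact r y z)) (ract r y z)

/-- lr3 : `(^x y)^(^(x^y) z) = ^(x^(^y z))(y^z)`. -/
def CondLR3 (r : X × X → X × X) : Prop :=
  ∀ x y z : X,
    ract r (lact r x y) (lact r (ract r x y) z) =
      lact r (ract r x (lact r y z)) (ract r y z)

/-- Extended left action on pairs : `^x (y,z) = (^x y, ^(x^y) z)`. -/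
def lactPair (r : X × X → X × X) (x : X) (p : X × X) : X × X :=
  (lact r x p.1, lact r (ract r x p.1) p.2)

/-- Extended right action on pairs : `(x,y)^z = (x^(^y z), y^z)`. -/
def ractPair (r : X × X → X × X) (p : X × X) (z : X) : X × X :=
  (ract r p.1 (lact r p.2 z), ract r p.2 z)

/-- l2 : `r (^x (y,z)) = ^x (r (y,z))`. -/
def CondL2 (r : X × X → X × X) : Prop :=
  ∀ x y z : X, r (lactPair r x (y, z)) = lactPair r x (r (y, z))

/-- r2 : `r ((x,y)^z) = (r (x,y))^z`. -/
def CondR2 (r : X × X → X × X) : Prop :=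
  ∀ x y z : X, r (ractPair r (x, y) z) = ractPair r (r (x, y)) z

/-- Non-degeneracy: all left actions `L_x` and right actions `R_x` are bijective. -/
def Nondeg (r : X × X → X × X) : Prop :=
  (∀ x : X, Function.Bijective (lact r x)) ∧
    (∀ x : X, Function.Bijective fun y => ract r y x)

def SquareFree (r : X × X → X × X) : Prop := ∀ x : X, r (x, x) = (x, x)

/-- lri : `(^x y)^x = y = ^x (y^x)`. -/
def CondLRI (r : X × X → X × X) : Prop :=
  ∀ x y : X, ract r (lact r x y) x = y ∧ lact r x (ract r y x) = y

/-- cl1 : `^(y^x) x = ^y x`. -/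
def CondCL1 (r : X × X → X × X) : Prop := ∀ x y : X, lact r (ract r y x) x = lact r y x

/-- cr1 : `x^(^x y) = x^y`. -/
def CondCR1 (r : X × X → X × X) : Prop := ∀ x y : X, ract r x (lact r x y) = ract r x y

/-- cl2 : `^(^x y) x = ^y x`. -/
def CondCL2 (r : X × X → X × X) : Prop := ∀ x y : X, lact r (lact r x y) x = lact r y x

/-- cr2 : `x^(y^x) = x^y`. -/
def CondCR2 (r : X × X → X × X) : Prop := ∀ x y : X, ract r x (ract r y x) = ract r x y

/-- cyclic : all four cyclic conditions. -/
def IsCyclic (r : X × X → X × X) : Prop := CondCL1 r ∧ CondCR1 r ∧ CondCL2 r ∧ CondCR2 r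

/-- csl (left cycle set condition) : `^(^y t)(^y x) = ^(^t y)(^t x)`. -/
def CondCSL (r : X × X → X × X) : Prop :=
  ∀ x y t : X, lact r (lact r y t) (lact r y x) = lact r (lact r t y) (lact r t x)

/-- csr (right cycle set condition) : `(x^y)^(t^y) = (x^t)^(y^t)`. -/
def CondCSR (r : X × X → X × X) : Prop :=
  ∀ x y t : X, ract r (ract r x y) (ract r t y) = ract r (ract r x t) (ract r y t)

def LeftTwoCancellative (r : X × X → X × X) : Prop :=
  ∀ k : ℕ, 1 ≤ k → ∀ x y z : X, r^[k] (x, y) = (x, z) → z = y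

def RightTwoCancellative (r : X × X → X × X) : Prop :=
  ∀ k : ℕ, 1 ≤ k → ∀ x y t : X, r^[k] (x, y) = (t, y) → t = x

def TwoCancellative (r : X × X → X × X) : Prop :=
  LeftTwoCancellative r ∧ RightTwoCancellative r

/-- The defining relations `x y = (^x y)(x^y)` of the monoid `S(X,r)`. -/
def ybRel (r : X × X → X × X) : FreeMonoid X → FreeMonoid X → Prop :=
  fun a b => ∃ x y : X,
    a = FreeMonoid.of x * FreeMonoid.of y ∧
      b = FreeMonoid.of (lact r x y) * FreeMonoid.of (ract r x y)

def ybCon (r : X × X → X × X) : Con (FreeMonoid X) := conGen (ybRel r)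

/-- The monoid `S(X,r)` associated with a quadratic set. -/
abbrev YBM (r : X × X → X × X) := (ybCon r).Quotient

/-- The image in `S(X,r)` of a generator `x ∈ X`. -/
def gen (r : X × X → X × X) (x : X) : YBM r := (ybCon r).mk' (FreeMonoid.of x)

/-- Left cancellation on monomials of length 2 in `S(X,r)`. -/
def LeftCancel2 (r : X × X → X × X) : Prop :=
  ∀ x y z : X, gen r x * gen r y = gen r x * gen r z → y = z

/-- Right cancellation on monomials of length 2 in `S(X,r)`. -/
def RightCancel2 (r : X × X → X × X) : Prop :=
  ∀ x y z : X, gen r y * gen r x = gen r z * gen r x → y = z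

/-- Cancellation on monomials of length 3 in `S(X,r)`. -/
def Cancel3 (r : X × X → X × X) : Prop :=
  (∀ x y z p q : X,
      gen r x * gen r y * gen r z = gen r x * gen r p * gen r q →
        gen r y * gen r z = gen r p * gen r q) ∧
    (∀ x y z p q : X,
      gen r y * gen r z * gen r x = gen r p * gen r q * gen r x →
        gen r y * gen r z = gen r p * gen r q)

/-- A matched pair structure `(S,S)` on a monoid `S` with the M3 property. -/
structure M3Structure (S : Type*) [Monoid S] where
  lact : S → S → S
  ract : S → S → S
  one_lact : ∀ v : S, lact 1 v = v
  mul_lact : ∀ u w v : S, lact (u * w) v = lact u (lact w v)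
  ract_one : ∀ u : S, ract u 1 = u
  ract_mul : ∀ u v w : S, ract u (v * w) = ract (ract u v) w
  lact_one : ∀ u : S, lact u 1 = 1
  one_ract : ∀ v : S, ract 1 v = 1
  lact_mul : ∀ u v w : S, lact u (v * w) = lact u v * lact (ract u v) w
  mul_ract : ∀ u w v : S, ract (u * w) v = ract u (lact w v) * ract w v
  m3 : ∀ u v : S, lact u v * ract u v = u * v

/-- The associated map `r_S (u,v) = (^u v, u^v)` of an M3-monoid. -/
def M3Structure.map {S : Type*} [Monoid S] (M : M3Structure S) : S × S → S × S :=
  fun p => (M.lact p.1 p.2, M.ract p.1 p.2)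

/-- The map `σ (α, x) = (^α x, α^x)` built from a pair of ground actions. -/
def groundMap (gl : Y → X → X) (gr : Y → X → Y) : Y × X → X × Y :=
  fun p => (gl p.1 p.2, gr p.1 p.2)

/-- The regular extension `(Z, r)`, `Z = X ⊔ Y`, of `(X, rX)` and `(Y, rY)` along
ground actions `gl, gr` with `σinv` inverting `σ = groundMap gl gr`. -/
def extMap (rX : X × X → X × X) (rY : Y × Y → Y × Y)
    (gl : Y → X → X) (gr : Y → X → Y) (σinv : X × Y → Y × X) :
    (X ⊕ Y) × (X ⊕ Y) → (X ⊕ Y) × (X ⊕ Y) :=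
  fun p =>
    match p with
    | (Sum.inl x, Sum.inl y) => (Sum.inl (rX (x, y)).1, Sum.inl (rX (x, y)).2)
    | (Sum.inr a, Sum.inr b) => (Sum.inr (rY (a, b)).1, Sum.inr (rY (a, b)).2)
    | (Sum.inr a, Sum.inl x) => (Sum.inl (gl a x), Sum.inr (gr a x))
    | (Sum.inl x, Sum.inr a) => (Sum.inr (σinv (x, a)).1, Sum.inl (σinv (x, a)).2)

/-- ml1 : `^α(^β x) = ^(^α β)(^(α^β) x)`. -/
def CondML1 (rY : Y × Y → Y × Y) (gl : Y → X → X) (gr : Y → X → Y) : Prop :=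
  ∀ (α β : Y) (x : X), gl α (gl β x) = gl (lact rY α β) (gl (ract rY α β) x)

/-- mr1 : `(α^x)^y = (α^(^x y))^(x^y)`. -/
def CondMR1 (rX : X × X → X × X) (gr : Y → X → Y) : Prop :=
  ∀ (α : Y) (x y : X), gr (gr α x) y = gr (gr α (lact rX x y)) (ract rX x y)

/-- ml2 : `rX (^α (x,y)) = ^α (rX (x,y))`. -/
def CondML2 (rX : X × X → X × X) (gl : Y → X → X) (gr : Y → X → Y) : Prop :=
  ∀ (α : Y) (x y : X),
    rX (gl α x, gl (gr α x) y) =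
      (gl α (lact rX x y), gl (gr α (lact rX x y)) (ract rX x y))

/-- mr2 : `(rY (α,β))^x = rY ((α,β)^x)`. -/
def CondMR2 (rY : Y × Y → Y × Y) (gl : Y → X → X) (gr : Y → X → Y) : Prop :=
  ∀ (α β : Y) (x : X),
    (gr (lact rY α β) (gl (ract rY α β) x), gr (ract rY α β) x) =
      rY (gr α (gl β x), gr β x)

/-- ml1a : `^α(^x y) = ^(^α x)(^(α^x) y)`. -/
def CondML1A (rX : X × X → X × X) (gl : Y → X → X) (gr : Y → X → Y) : Prop :=
  ∀ (α : Y) (x y : X),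
    gl α (lact rX x y) = lact rX (gl α x) (gl (gr α x) y)

/-- mr1a : `(α^β)^x = (α^(^β x))^(β^x)`. -/
def CondMR1A (rY : Y × Y → Y × Y) (gl : Y → X → X) (gr : Y → X → Y) : Prop :=
  ∀ (α β : Y) (x : X),
    gr (ract rY α β) x = ract rY (gr α (gl β x)) (gr β x)


/-- Truncation of `S(X,r)` at degree 2. -/
inductive Trunc2 {X : Type*} (f : Equiv.Perm (X × X)) where
  | one : Trunc2 f
  | el : X → Trunc2 f
  | pr : Quotient (Equiv.Perm.SameCycle.setoid f) → Trunc2 f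
  | top : Trunc2 f

def Trunc2.mulAux {X : Type*} {f : Equiv.Perm (X × X)} : Trunc2 f → Trunc2 f → Trunc2 f
  | .one, b => b
  | a, .one => a
  | .el x, .el y => .pr (Quotient.mk _ (x, y))
  | _, _ => .top

instance {X : Type*} (f : Equiv.Perm (X × X)) : Monoid (Trunc2 f) where
  mul := Trunc2.mulAux
  one := .one
  mul_assoc a b c := by
    change Trunc2.mulAux (Trunc2.mulAux a b) c = Trunc2.mulAux a (Trunc2.mulAux b c)
    cases a <;> cases b <;> cases c <;> rfl
  one_mul a := by
    change Trunc2.mulAux .one a = a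
    cases a <;> rfl
  mul_one a := by
    change Trunc2.mulAux a .one = a
    cases a <;> rfl

theorem gen_mul {X : Type*} (r : X × X → X × X) (x y : X) :
    gen r x * gen r y = gen r (lact r x y) * gen r (ract r x y) := by
  have h : ybCon r (FreeMonoid.of x * FreeMonoid.of y)
      (FreeMonoid.of (lact r x y) * FreeMonoid.of (ract r x y)) :=
    ConGen.Rel.of _ _ ⟨x, y, rfl, rfl⟩
  exact (Con.eq (ybCon r)).2 h

theorem sameCycle_of_gen {X : Type*} (r : X × X → X × X) (hr : Function.Bijective r)
    (x y z t : X) (h : gen r x * gen r y = gen r z * gen r t) :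
    Equiv.Perm.SameCycle (Equiv.ofBijective r hr) (x, y) (z, t) := by
  have h' : ybCon r (FreeMonoid.of x * FreeMonoid.of y)
      (FreeMonoid.of z * FreeMonoid.of t) := (Con.eq (ybCon r)).1 h
  have hle : ybCon r ≤ Con.ker (FreeMonoid.lift
      (fun x => (Trunc2.el x : Trunc2 (Equiv.ofBijective r hr)))) := by
    refine Con.conGen_le.2 ?_
    rintro _ _ ⟨a, b, rfl, rfl⟩
    rw [Con.ker_rel]
    simp only [map_mul, FreeMonoid.lift_eval_of]
    refine congrArg Trunc2.pr (Quotient.sound ?_)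
    exact ⟨1, rfl⟩
  have h2 := hle h'
  rw [Con.ker_rel] at h2
  simp only [map_mul, FreeMonoid.lift_eval_of] at h2
  exact Quotient.exact (Trunc2.pr.inj h2)

theorem iter_of_sameCycle {X : Type*} (r : X × X → X × X) (hr : Function.Bijective r)
    (p q : X × X) (h : Equiv.Perm.SameCycle (Equiv.ofBijective r hr) p q) :
    p = q ∨ ∃ k : ℕ, 1 ≤ k ∧ (r^[k] p = q ∨ r^[k] q = p) := by
  obtain ⟨i, hi⟩ := h
  have key : ∀ (k : ℕ) (p : X × X), ((Equiv.ofBijective r hr : Equiv.Perm (X × X)) ^ k) p = r^[k] p := by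
    intro k p
    rw [← Equiv.Perm.iterate_eq_pow]
    rfl
  obtain ⟨k, rfl | rfl⟩ := i.eq_nat_or_neg
  · rw [zpow_natCast, key] at hi
    rcases Nat.eq_zero_or_pos k with rfl | hk
    · exact Or.inl hi
    · exact Or.inr ⟨k, hk, Or.inl hi⟩
  · rw [zpow_neg, zpow_natCast, Equiv.Perm.inv_eq_iff_eq, key] at hi
    rcases Nat.eq_zero_or_pos k with rfl | hk
    · exact Or.inl hi
    · exact Or.inr ⟨k, hk, Or.inr hi.symm⟩

theorem leftCancel2 {X : Type*} (r : X × X → X × X) (hr : Function.Bijective r)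
    (h2c : TwoCancellative r) : LeftCancel2 r := by
  intro x y z h
  rcases iter_of_sameCycle r hr _ _ (sameCycle_of_gen r hr _ _ _ _ h) with h | ⟨k, hk, h | h⟩
  · exact (Prod.mk.inj h).2
  · exact (h2c.1 k hk _ _ _ h).symm
  · exact h2c.1 k hk _ _ _ h

theorem rightCancel2 {X : Type*} (r : X × X → X × X) (hr : Function.Bijective r)
    (h2c : TwoCancellative r) : RightCancel2 r := by
  intro x y z h
  rcases iter_of_sameCycle r hr _ _ (sameCycle_of_gen r hr _ _ _ _ h) with h | ⟨k, hk, h | h⟩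
  · exact (Prod.mk.inj h).1
  · exact (h2c.2 k hk _ _ _ h).symm
  · exact h2c.2 k hk _ _ _ h

theorem condL2_iff {X : Type*} (r : X × X → X × X) : CondL2 r ↔ CondL1 r ∧ CondLR3 r := by
  constructor
  · intro h
    exact ⟨fun x y z => (congrArg Prod.fst (h x y z)).symm,
      fun x y z => congrArg Prod.snd (h x y z)⟩
  · rintro ⟨h1, h3⟩ x y z
    exact Prod.ext (h1 x y z).symm (h3 x y z)

theorem condR2_iff {X : Type*} (r : X × X → X × X) : CondR2 r ↔ CondR1 r ∧ CondLR3 r := by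
  constructor
  · intro h
    exact ⟨fun x y z => (congrArg Prod.snd (h x y z)).symm,
      fun x y z => (congrArg Prod.fst (h x y z)).symm⟩
  · rintro ⟨h1, h3⟩ x y z
    exact Prod.ext (h3 x y z).symm (h1 x y z).symm

theorem braided_iff {X : Type*} (r : X × X → X × X) :
    IsBraided r ↔ CondL1 r ∧ CondR1 r ∧ CondLR3 r := by
  constructor
  · intro h
    have h' := fun x y z => congrFun h (x, y, z)
    exact ⟨fun x y z => (congrArg Prod.fst (h' x y z)).symm,
      fun x y z => congrArg (fun p => p.2.2) (h' x y z),
      fun x y z => congrArg (fun p => p.2.1) (h' x y z)⟩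
  · rintro ⟨h1, h2, h3⟩
    funext ⟨x, y, z⟩
    exact Prod.ext (h1 x y z).symm (Prod.ext (h3 x y z) (h2 x y z))

theorem triple_eq {X : Type*} (r : X × X → X × X) (x y z : X) :
    gen r (lact r (lact r x y) (lact r (ract r x y) z)) *
      gen r (ract r (lact r x y) (lact r (ract r x y) z)) * gen r (ract r (ract r x y) z) =
    gen r (lact r x (lact r y z)) *
      gen r (lact r (ract r x (lact r y z)) (ract r y z)) *
      gen r (ract r (ract r x (lact r y z)) (ract r y z)) := by
  rw [← gen_mul, mul_assoc, ← gen_mul, ← mul_assoc, ← gen_mul]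
  rw [mul_assoc (gen r (lact r x (lact r y z))), ← gen_mul, ← mul_assoc, ← gen_mul,
    mul_assoc, mul_assoc, ← gen_mul r y z]

/-- Lemma 2.27: for a 2-cancellative quadratic set whose monoid
`S(X,r)` cancels on monomials of length 3: (i) l2 ⇔ r2 ⇔ (l1 & r1) ⇔ braided;
(ii) if moreover `r` is non-degenerate and involutive then
l1 ⇔ r1 ⇔ symmetric set. -/
theorem cancellative_braided_characterisation {X : Type*} [Nonempty X]
    (r : X × X → X × X) (hr : Function.Bijective r)
    (h2c : TwoCancellative r) (h3c : Cancel3 r) :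
    ([CondL2 r, CondR2 r, CondL1 r ∧ CondR1 r, IsBraided r].TFAE) ∧
      (Nondeg r → Function.Involutive r →
        ((CondL1 r ↔ CondR1 r) ∧
          (CondR1 r ↔ (IsBraided r ∧ Function.Involutive r)))) := by
  have hl := leftCancel2 r hr h2c
  have hrr := rightCancel2 r hr h2c
  have L2R : CondL1 r → CondLR3 r → CondR1 r := by
    intro h1 h3 x y z
    have h := triple_eq r x y z
    rw [← h1, h3] at h
    exact hl _ _ _ (h3c.1 _ _ _ _ _ h)
  have R2L : CondR1 r → CondLR3 r → CondL1 r := by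
    intro h1 h3 x y z
    have h := triple_eq r x y z
    rw [h1, h3] at h
    exact (hrr _ _ _ (h3c.2 _ _ _ _ _ h)).symm
  have LR : CondL1 r → CondR1 r → CondLR3 r := by
    intro h1 h2 x y z
    have h := triple_eq r x y z
    rw [← h1, h2] at h
    exact hrr _ _ _ (h3c.1 _ _ _ _ _ h)
  refine ⟨?_, ?_⟩
  · rw [condL2_iff, condR2_iff, braided_iff]
    tfae_have 1 → 2 := fun h => ⟨L2R h.1 h.2, h.2⟩
    tfae_have 2 → 3 := fun h => ⟨R2L h.1 h.2, h.1⟩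
    tfae_have 3 → 4 := fun h => ⟨h.1, h.2, LR h.1 h.2⟩
    tfae_have 4 → 1 := fun h => ⟨h.1, h.2.2⟩
    tfae_finish
  · intro hnd hinv
    have il : ∀ x y, lact r (lact r x y) (ract r x y) = x :=
      fun x y => congrArg Prod.fst (hinv (x, y))
    have ir : ∀ x y, ract r (lact r x y) (ract r x y) = y :=
      fun x y => congrArg Prod.snd (hinv (x, y))
    have A : CondL1 r → CondLR3 r := by
      intro h1 x y z
      apply (hnd.1 (lact r x (lact r y z))).1
      rw [← h1 x (lact r y z) (ract r y z), il, h1 x y z, il]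
    have B : CondR1 r → CondLR3 r := by
      intro h1 x y z
      apply (hnd.2 (ract r (ract r x y) z)).1
      change ract r _ _ = ract r _ _
      rw [← h1 (lact r x y) (ract r x y) z, ir, h1 x y z, ir]
    refine ⟨⟨fun h => L2R h (A h), fun h => R2L h (B h)⟩, ?_⟩
    rw [braided_iff]
    exact ⟨fun h => ⟨⟨R2L h (B h), h, B h⟩, hinv⟩, fun h => h.1.2.1⟩

end YB
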